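/- Let ν > 0 and ε ∈ ℝ with |ε| < 1, set α = |ε|/ν and ⟨t⟩ = (1+t²)^{1/2}. Let u : ℝ → ℂ be twice continuously differentiable and suppose there is δ > |ε|/(2ν) with ∫_ℝ e^{2δ⟨t⟩}(|u(t)|² + |u′(t)|² + |u″(t)|²) dt < ∞. Set f(t) = u″(t) + (ν² − iε)u(t). Then ν² ∫_ℝ e^{α|t|} |u(t)|² dt ≤ ∫_ℝ |f(t)|² t² e^{α|t|} dt. -/

import Mathlib

open MeasureTheory Real

/-- The weight `t e^{a|t|}` is differentiable everywhere, including at the origin. -/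
lemma hasDerivAt_mul_exp_mul_abs (a t : ℝ) :
    HasDerivAt (fun s : ℝ => s * exp (a * |s|)) (exp (a * |t|) * (1 + a * |t|)) t := by
  rcases lt_trichotomy t 0 with ht | rfl | ht
  · have h := (hasDerivAt_id t).mul (((hasDerivAt_abs_neg ht).const_mul a).exp)
    refine h.congr_deriv ?_
    rw [abs_of_neg ht, id]
    ring
  · rw [hasDerivAt_iff_tendsto_slope]
    have hc : Continuous fun s : ℝ => exp (a * |s|) := by fun_prop
    have h := (hc.tendsto 0).mono_left (nhdsWithin_le_nhds (s := {0}ᶜ))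
    simp only [abs_zero, mul_zero, exp_zero, add_zero, mul_one] at h ⊢
    refine h.congr' ?_
    filter_upwards [self_mem_nhdsWithin] with s hs
    have hs' : s ≠ 0 := hs
    simp [slope_def_field, hs']
  · have h := (hasDerivAt_id t).mul (((hasDerivAt_abs_pos ht).const_mul a).exp)
    refine h.congr_deriv ?_
    rw [abs_of_pos ht, id]
    ring

/-- A stronger exponential weight absorbs the polynomial factor `1 + t²`. -/
lemma one_add_sq_mul_exp_le {a b : ℝ} (ha : 0 ≤ a) (hab : a < b) (t : ℝ) :
    (1 + t ^ 2) * exp (a * |t|) ≤ 2 / (b - a) ^ 2 * exp (b * √(1 + t ^ 2)) := by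
  set s := √(1 + t ^ 2) with hs
  have hs2 : s ^ 2 = 1 + t ^ 2 := sq_sqrt (by positivity)
  have hs0 : 0 ≤ s := sqrt_nonneg _
  have hts : |t| ≤ s := abs_le_sqrt (by linarith)
  have hd : 0 < b - a := sub_pos.2 hab
  have h1 : exp (a * |t|) ≤ exp (a * s) := by gcongr
  have h2 : s ^ 2 ≤ 2 / (b - a) ^ 2 * exp ((b - a) * s) := by
    have h := quadratic_le_exp_of_nonneg (mul_nonneg hd.le hs0)
    have h' : ((b - a) * s) ^ 2 / 2 ≤ exp ((b - a) * s) := by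
      nlinarith [mul_nonneg hd.le hs0]
    calc s ^ 2 = 2 / (b - a) ^ 2 * (((b - a) * s) ^ 2 / 2) := by field_simp
      _ ≤ _ := by gcongr
  calc (1 + t ^ 2) * exp (a * |t|)
      ≤ (2 / (b - a) ^ 2 * exp ((b - a) * s)) * exp (a * s) := by
        rw [← hs2]; gcongr
    _ = 2 / (b - a) ^ 2 * exp (b * s) := by
        rw [mul_assoc, ← exp_add]; ring_nf

/-- Pointwise form of the estimate, with `x, y, z` the values of `u, u′, u″` at `t` and `w` the
weight: the last two terms are the derivative of `t w (|u′|² + ν²|u|²)`. -/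
lemma pointwise_multiplier_estimate {ν w : ℝ} (hν : 0 < ν) (hw : 0 ≤ w) (ε t : ℝ) (x y z : ℂ) :
    ν ^ 2 * (w * ‖x‖ ^ 2) ≤
      ‖z + ((ν : ℂ) ^ 2 - Complex.I * ε) * x‖ ^ 2 * t ^ 2 * w +
        (w * (1 + |ε| / ν * |t|) * (‖y‖ ^ 2 + ν ^ 2 * ‖x‖ ^ 2) +
          t * w * (2 * inner ℝ y z + ν ^ 2 * (2 * inner ℝ x y))) := by
  set f := z + ((ν : ℂ) ^ 2 - Complex.I * ε) * x with hf
  have hinner : inner ℝ y z + ν ^ 2 * inner ℝ x y =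
      inner ℝ y f + inner ℝ y (Complex.I * ε * x) := by
    rw [← inner_add_right, real_inner_comm y x, ← real_inner_smul_right, ← inner_add_right]
    congr 1
    rw [hf, Complex.real_smul]
    push_cast
    ring
  have h1 : |inner ℝ y f + inner ℝ y (Complex.I * ε * x)| ≤ ‖y‖ * ‖f‖ + ‖y‖ * (|ε| * ‖x‖) := by
    refine (abs_add_le _ _).trans (add_le_add (abs_real_inner_le_norm _ _) ?_)
    refine (abs_real_inner_le_norm _ _).trans_eq ?_
    simp
  have h2 : -(|t| * (‖y‖ * ‖f‖ + ‖y‖ * (|ε| * ‖x‖))) ≤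
      t * (inner ℝ y f + inner ℝ y (Complex.I * ε * x)) := by
    refine neg_le_of_abs_le ?_
    rw [abs_mul]
    gcongr
  have h3 : 2 * (|ε| * (‖y‖ * ‖x‖)) ≤ |ε| / ν * (‖y‖ ^ 2 + ν ^ 2 * ‖x‖ ^ 2) := by
    rw [div_mul_eq_mul_div, le_div_iff₀ hν]
    nlinarith [mul_nonneg (abs_nonneg ε) (sq_nonneg (‖y‖ - ν * ‖x‖))]
  have h4 := mul_le_mul_of_nonneg_left h3 (abs_nonneg t)
  have h5 : 2 * (|t| * (‖y‖ * ‖f‖)) ≤ ‖f‖ ^ 2 * t ^ 2 + ‖y‖ ^ 2 := by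
    rw [← sq_abs t]
    nlinarith [sq_nonneg (|t| * ‖f‖ - ‖y‖)]
  have h6 : ν ^ 2 * ‖x‖ ^ 2 ≤ ‖f‖ ^ 2 * t ^ 2 +
      ((1 + |ε| / ν * |t|) * (‖y‖ ^ 2 + ν ^ 2 * ‖x‖ ^ 2) +
        2 * (t * (inner ℝ y z + ν ^ 2 * inner ℝ x y))) := by
    rw [hinner]
    linarith
  linarith [mul_le_mul_of_nonneg_left h6 hw]

/-- Zeroth-order estimate for the 1-D Schrödinger equation `u″ + (ν² − iε)u = f`
with absorption: with `α = |ε|/ν`, if `∫ e^{2δ⟨t⟩}(|u|² + |u′|² + |u″|²) < ∞` for some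
`δ > |ε|/(2ν)`, then `ν² ∫ e^{α|t|}|u(t)|² dt ≤ ∫ |f(t)|² t² e^{α|t|} dt`. -/
theorem schrodinger_zeroth_order_estimate (ν ε : ℝ) (hν : 0 < ν) (hε : |ε| < 1)
    (u : ℝ → ℂ) (hu : ContDiff ℝ 2 u)
    (hdecay : ∃ δ : ℝ, |ε| / (2 * ν) < δ ∧
      Integrable (fun t : ℝ => Real.exp (2 * δ * Real.sqrt (1 + t ^ 2)) *
        (‖u t‖ ^ 2 + ‖deriv u t‖ ^ 2 + ‖deriv (deriv u) t‖ ^ 2))) :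
    ν ^ 2 * ∫ t : ℝ, Real.exp (|ε| / ν * |t|) * ‖u t‖ ^ 2 ≤
      ∫ t : ℝ, ‖deriv (deriv u) t + ((ν : ℂ) ^ 2 - Complex.I * ε) * u t‖ ^ 2 *
          t ^ 2 * Real.exp (|ε| / ν * |t|) := by
  obtain ⟨δ, hδ, hint⟩ := hdecay
  set α := |ε| / ν with hα
  have hα0 : 0 ≤ α := by positivity
  have hαδ : α < 2 * δ := by
    have h : α = 2 * (|ε| / (2 * ν)) := by rw [hα]; field_simp
    linarith
  have hu1 : ContDiff ℝ 1 (deriv u) := ((contDiff_succ_iff_deriv (n := 1)).1 hu).2.2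
  have hc0 : Continuous u := hu.continuous
  have hc1 : Continuous (deriv u) := hu1.continuous
  have hc2 : Continuous (deriv (deriv u)) := hu1.continuous_deriv le_rfl
  have hd0 : ∀ t, HasDerivAt u (deriv u t) t := fun t =>
    (hu.differentiable two_ne_zero t).hasDerivAt
  have hd1 : ∀ t, HasDerivAt (deriv u) (deriv (deriv u) t) t := fun t =>
    (hu1.differentiable one_ne_zero t).hasDerivAt
  have key : ∀ (g : ℝ → ℝ), Continuous g → ∀ C : ℝ, 0 ≤ C →
      (∀ t, |g t| ≤ C * ((1 + t ^ 2) * exp (α * |t|) *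
        (‖u t‖ ^ 2 + ‖deriv u t‖ ^ 2 + ‖deriv (deriv u) t‖ ^ 2))) → Integrable g := by
    intro g hg C hC hb
    refine (hint.const_mul (C * (2 / (2 * δ - α) ^ 2))).mono' hg.aestronglyMeasurable
      (.of_forall fun t => (hb t).trans ?_)
    rw [mul_assoc C, ← mul_assoc (2 / (2 * δ - α) ^ 2)]
    exact mul_le_mul_of_nonneg_left (mul_le_mul_of_nonneg_right
      (one_add_sq_mul_exp_le hα0 hαδ t) (by positivity)) hC
  have ht : ∀ t : ℝ, |t| ≤ 1 + t ^ 2 := fun t => by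
    rw [← sq_abs t]; nlinarith [sq_nonneg (|t| - 1)]
  set E : ℝ → ℝ := fun t => ‖deriv u t‖ ^ 2 + ν ^ 2 * ‖u t‖ ^ 2 with hE
  set G : ℝ → ℝ := fun t => t * exp (α * |t|) * E t with hG
  set G' : ℝ → ℝ := fun t => exp (α * |t|) * (1 + α * |t|) * E t + t * exp (α * |t|) *
    (2 * inner ℝ (deriv u t) (deriv (deriv u) t) + ν ^ 2 * (2 * inner ℝ (u t) (deriv u t))) with hG'
  have hderiv : ∀ t, HasDerivAt G (G' t) t := fun t =>
    (hasDerivAt_mul_exp_mul_abs α t).mul ((hd1 t).norm_sq.add ((hd0 t).norm_sq.const_mul (ν ^ 2)))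
  have hEb : ∀ t, E t ≤ (1 + ν ^ 2) *
      (‖u t‖ ^ 2 + ‖deriv u t‖ ^ 2 + ‖deriv (deriv u) t‖ ^ 2) := fun t => by
    simp only [hE]
    nlinarith [sq_nonneg ‖u t‖, sq_nonneg ‖deriv (deriv u) t‖,
      mul_nonneg (sq_nonneg ν) (sq_nonneg ‖deriv u t‖),
      mul_nonneg (sq_nonneg ν) (sq_nonneg ‖deriv (deriv u) t‖)]
  have hE0 : ∀ t, 0 ≤ E t := fun t => by positivity
  have hGi : Integrable G := by
    refine key G (by fun_prop) (1 + ν ^ 2) (by positivity) fun t => ?_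
    rw [hG, abs_mul, abs_mul, abs_exp, abs_of_nonneg (hE0 t)]
    calc |t| * exp (α * |t|) * E t ≤ (1 + t ^ 2) * exp (α * |t|) * ((1 + ν ^ 2) *
          (‖u t‖ ^ 2 + ‖deriv u t‖ ^ 2 + ‖deriv (deriv u) t‖ ^ 2)) := by
          gcongr
          exacts [ht t, hEb t]
      _ = _ := by ring
  have hG'i : Integrable G' := by
    refine key G' (by fun_prop) ((2 + α) * (1 + ν ^ 2)) (by positivity) fun t => ?_
    set S := ‖u t‖ ^ 2 + ‖deriv u t‖ ^ 2 + ‖deriv (deriv u) t‖ ^ 2 with hS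
    have hyz := abs_real_inner_le_norm (deriv u t) (deriv (deriv u) t)
    have hxy := abs_real_inner_le_norm (u t) (deriv u t)
    have hI : |2 * inner ℝ (deriv u t) (deriv (deriv u) t) +
        ν ^ 2 * (2 * inner ℝ (u t) (deriv u t))| ≤ (1 + ν ^ 2) * S := by
      have h1 : |2 * inner ℝ (deriv u t) (deriv (deriv u) t)| ≤ S := by
        rw [abs_mul, abs_two]
        nlinarith [sq_nonneg (‖deriv u t‖ - ‖deriv (deriv u) t‖), sq_nonneg ‖u t‖]
      have h2 : |2 * inner ℝ (u t) (deriv u t)| ≤ S := by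
        rw [abs_mul, abs_two]
        nlinarith [sq_nonneg (‖u t‖ - ‖deriv u t‖), sq_nonneg ‖deriv (deriv u) t‖]
      calc _ ≤ _ := abs_add_le _ _
        _ = |2 * inner ℝ (deriv u t) (deriv (deriv u) t)| +
            ν ^ 2 * |2 * inner ℝ (u t) (deriv u t)| := by
          rw [abs_mul (ν ^ 2), abs_of_nonneg (sq_nonneg ν)]
        _ ≤ S + ν ^ 2 * S := by gcongr
        _ = _ := by ring
    have h1 : 1 + α * |t| ≤ (1 + α) * (1 + t ^ 2) := by
      nlinarith [mul_le_mul_of_nonneg_left (ht t) hα0, sq_nonneg t]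
    calc |G' t| ≤ _ := abs_add_le _ _
      _ = exp (α * |t|) * (1 + α * |t|) * E t + |t| * exp (α * |t|) *
          |2 * inner ℝ (deriv u t) (deriv (deriv u) t) +
            ν ^ 2 * (2 * inner ℝ (u t) (deriv u t))| := by
        rw [abs_of_nonneg (mul_nonneg (by positivity) (hE0 t)), abs_mul, abs_mul, abs_exp]
      _ ≤ exp (α * |t|) * ((1 + α) * (1 + t ^ 2)) * ((1 + ν ^ 2) * S) +
          (1 + t ^ 2) * exp (α * |t|) * ((1 + ν ^ 2) * S) := by
        gcongr
        exacts [hEb t, ht t]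
      _ = _ := by ring
  have hui : Integrable fun t => exp (α * |t|) * ‖u t‖ ^ 2 := by
    refine key _ (by fun_prop) 1 zero_le_one fun t => ?_
    rw [abs_of_nonneg (by positivity), one_mul]
    gcongr
    · nlinarith [exp_pos (α * |t|), mul_nonneg (sq_nonneg t) (exp_pos (α * |t|)).le]
    · nlinarith [sq_nonneg ‖deriv u t‖, sq_nonneg ‖deriv (deriv u) t‖]
  have hfi : Integrable fun t => ‖deriv (deriv u) t + ((ν : ℂ) ^ 2 - Complex.I * ε) * u t‖ ^ 2 *
      t ^ 2 * exp (α * |t|) := by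
    set c : ℂ := (ν : ℂ) ^ 2 - Complex.I * ε
    refine key _ (by fun_prop) (2 + 2 * ‖c‖ ^ 2) (by positivity) fun t => ?_
    rw [abs_of_nonneg (by positivity)]
    have hn : ‖deriv (deriv u) t + c * u t‖ ^ 2 ≤ (2 + 2 * ‖c‖ ^ 2) *
        (‖u t‖ ^ 2 + ‖deriv u t‖ ^ 2 + ‖deriv (deriv u) t‖ ^ 2) := by
      have h := norm_add_le (deriv (deriv u) t) (c * u t)
      rw [norm_mul] at h
      calc _ ≤ (‖deriv (deriv u) t‖ + ‖c‖ * ‖u t‖) ^ 2 := by gcongr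
        _ ≤ 2 * (‖deriv (deriv u) t‖ ^ 2 + (‖c‖ * ‖u t‖) ^ 2) := add_sq_le
        _ ≤ _ := by
          have h1 : 0 ≤ ‖c‖ ^ 2 * ‖deriv u t‖ ^ 2 := by positivity
          have h2 : 0 ≤ ‖c‖ ^ 2 * ‖deriv (deriv u) t‖ ^ 2 := by positivity
          nlinarith [sq_nonneg ‖u t‖, sq_nonneg ‖deriv u t‖]
    calc _ ≤ (2 + 2 * ‖c‖ ^ 2) * (‖u t‖ ^ 2 + ‖deriv u t‖ ^ 2 + ‖deriv (deriv u) t‖ ^ 2) *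
          (1 + t ^ 2) * exp (α * |t|) := by
          gcongr
          linarith
      _ = _ := by ring
  have hzero : ∫ t, G' t = 0 := integral_eq_zero_of_hasDerivAt_of_integrable hderiv hG'i hGi
  rw [← integral_const_mul]
  calc _ ≤ ∫ t, (‖deriv (deriv u) t + ((ν : ℂ) ^ 2 - Complex.I * ε) * u t‖ ^ 2 *
        t ^ 2 * exp (α * |t|) + G' t) :=
      integral_mono (hui.const_mul _) (hfi.add hG'i) fun t =>
        pointwise_multiplier_estimate hν (exp_pos _).le ε t _ _ _
    _ = _ := by rw [integral_add hfi hG'i, hzero, add_zero]
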